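/- Let X be a subshift of {0,1}^ℤ with topological entropy h and density d = sup_ν ν([1]). If d ≤ 1/2, then h ≤ H(d), where H(p) = -p log₂ p - (1-p) log₂(1-p). In particular, h → 0 as d → 0. -/

import Mathlib

open MeasureTheory Filter Real
open scoped ENNReal

attribute [local instance] Classical.propDecidable

/-- The two-sided binary sequence space `{0,1}^ℤ`. -/
abbrev Omega : Type := ℤ → Bool

/-- The left shift. -/
def shift (x : Omega) : Omega := fun n => x (n + 1)

/-- The cylinder set of a word `W` of length `n`, read from coordinate `0`. -/
def cyl (n : ℕ) (W : Fin n → Bool) : Set Omega := {x | ∀ i : Fin n, x ((i : ℕ) : ℤ) = W i}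

/-- The language of `X`: words of length `n` appearing (at position 0) in some point of `X`. -/
def lang (X : Set Omega) (n : ℕ) : Set (Fin n → Bool) :=
  {W | ∃ x ∈ X, ∀ i : Fin n, x ((i : ℕ) : ℤ) = W i}

/-- Number of ones in a word. -/
def ones {n : ℕ} (W : Fin n → Bool) : ℕ := (Finset.univ.filter fun i => W i = true).card

/-- `maxOnes X n` is the maximal number of ones in an allowed word of length `n`. -/
noncomputable def maxOnes (X : Set Omega) (n : ℕ) : ℕ :=
  (Finset.univ.filter fun W : Fin n → Bool => W ∈ lang X n).sup ones

/-- `d(X,S)`: the supremum over shift-invariant Borel probability measures concentrated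
on `X` of the measure of the cylinder `[1] = {x | x 0 = true}`. -/
noncomputable def dsup (X : Set Omega) : ℝ :=
  ⨆ μ : {μ : Measure Omega // IsProbabilityMeasure μ ∧ μ X = 1 ∧ Measure.map shift μ = μ},
    ((μ : Measure Omega) {x | x 0 = true}).toReal

/-- Binary Shannon entropy `H(p) = -p log₂ p - (1-p) log₂ (1-p)` (with `H 0 = H 1 = 0`,
using the convention `logb 2 0 = 0`). -/
noncomputable def binEnt (p : ℝ) : ℝ := -(p * logb 2 p) - (1 - p) * logb 2 (1 - p)

theorem aux_count {n : ℕ} (S : Finset (Fin n → Bool)) (hS : S.Nonempty) (p : ℝ) (hp0 : 0 < p)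
    (hp : p ≤ 1 / 2) (h1 : ∀ W ∈ S, (ones W : ℝ) ≤ p * n) :
    Real.log S.card ≤ n * binEntropy p := by
  let w : (Fin n → Bool) → ℝ := fun W => ∏ i, (if W i = true then p else 1 - p)
  have hw0 : ∀ W, 0 < w W := fun W => Finset.prod_pos fun i _ => by split_ifs <;> linarith
  have htot : ∑ W, w W = 1 := by
    have := (Fintype.prod_sum (fun (_ : Fin n) (b : Bool) => if b = true then p else 1 - p))
    simp only [w]
    rw [← this]
    simp
  have hlog : ∀ W, Real.log (w W) = ones W * Real.log p + (n - ones W) * Real.log (1 - p) := by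
    intro W
    simp only [w]
    rw [Real.log_prod (fun i _ => by split_ifs <;> linarith)]
    have : ∀ i, Real.log (if W i = true then p else 1 - p) =
        (if W i = true then (1 : ℝ) else 0) * (Real.log p - Real.log (1 - p)) + Real.log (1 - p) := by
      intro i; split_ifs <;> ring
    simp only [this]
    rw [Finset.sum_add_distrib, ← Finset.sum_mul, Finset.sum_boole]
    simp [ones]
    ring
  have hle : Real.log p ≤ Real.log (1 - p) := Real.log_le_log hp0 (by linarith)
  have hge : ∀ W ∈ S, Real.exp (-(n * binEntropy p)) ≤ w W := by
    intro W hW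
    rw [← Real.exp_log (hw0 W), Real.exp_le_exp, hlog]
    have := mul_nonneg (sub_nonneg.2 (h1 W hW)) (sub_nonneg.2 hle)
    simp only [binEntropy, Real.log_inv]
    nlinarith
  have hc : S.card * Real.exp (-(n * binEntropy p)) ≤ 1 := by
    rw [← htot, ← nsmul_eq_mul]
    exact (Finset.card_nsmul_le_sum S w _ hge).trans
      (Finset.sum_le_sum_of_subset_of_nonneg (Finset.subset_univ _) fun W _ _ => (hw0 W).le)
  rw [Real.log_le_iff_le_exp (by exact_mod_cast hS.card_pos)]
  rw [Real.exp_neg, ← div_eq_mul_inv, div_le_one (Real.exp_pos _)] at hc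
  exact hc

theorem binEnt_eq (p : ℝ) : binEnt p = binEntropy p / Real.log 2 := by
  simp only [binEnt, binEntropy, logb, Real.log_inv]
  ring

theorem continuous_shift : Continuous shift :=
  continuous_pi fun n => continuous_apply (n + 1)

theorem iterate_shift (x : Omega) (i : ℕ) (m : ℤ) : shift^[i] x m = x (m + i) := by
  induction i generalizing m with
  | zero => simp
  | succ k ih =>
    rw [Function.iterate_succ_apply']
    simp only [shift]
    rw [ih]
    congr 1
    push_cast
    ring

theorem ones_eq (x : Omega) (n : ℕ) (W : Fin n → Bool) (hW : ∀ i : Fin n, x ((i : ℕ) : ℤ) = W i) :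
    (ones W : ℝ) = ∑ i ∈ Finset.range n, if (shift^[i] x) 0 = true then (1 : ℝ) else 0 := by
  rw [Finset.sum_range]
  simp only [iterate_shift, zero_add, hW, Finset.sum_boole]
  rfl

noncomputable def emp (x : Omega) (n : ℕ) : Measure Omega :=
  (n : ℝ≥0∞)⁻¹ • ∑ i ∈ Finset.range n, Measure.dirac (shift^[i] x)

theorem emp_prob (x : Omega) (n : ℕ) (hn : n ≠ 0) : IsProbabilityMeasure (emp x n) := by
  constructor
  simp [emp]
  exact ENNReal.inv_mul_cancel (by simpa using hn) (by simp)

theorem emp_X (X : Set Omega) (hX : MeasurableSet X) (hinv : shift '' X = X) (x : Omega)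
    (hx : x ∈ X) (n : ℕ) (hn : n ≠ 0) : emp x n X = 1 := by
  have hm : ∀ i : ℕ, shift^[i] x ∈ X := by
    intro i
    induction i with
    | zero => exact hx
    | succ k ih =>
      rw [Function.iterate_succ_apply', ← hinv]
      exact ⟨_, ih, rfl⟩
  simp [emp, hX, hm]
  exact ENNReal.inv_mul_cancel (by simpa using hn) (by simp)

theorem emp_integral (x : Omega) (n : ℕ) (f : Omega → ℝ) (hf : Continuous f) :
    ∫ y, f y ∂(emp x n) = (n : ℝ)⁻¹ * ∑ i ∈ Finset.range n, f (shift^[i] x) := by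
  rw [emp, integral_smul_measure, integral_finsetSum_measure]
  · simp
  · intro i _
    exact integrable_dirac (by simp)

theorem aux_measure (X : Set Omega) (hcl : IsClosed X) (hinv : shift '' X = X) (p : ℝ)
    (N : ℕ → ℕ) (hN : ∀ k, k + 1 ≤ N k) (x : ℕ → Omega) (hx : ∀ k, x k ∈ X)
    (hp : ∀ k, p * N k ≤ ∑ i ∈ Finset.range (N k), if (shift^[i] (x k)) 0 = true then (1 : ℝ) else 0) :
    ∃ ν : Measure Omega, (IsProbabilityMeasure ν ∧ ν X = 1 ∧ Measure.map shift ν = ν) ∧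
      p ≤ (ν {x | x 0 = true}).toReal := by
  have hN0 : ∀ k, N k ≠ 0 := fun k => by have := hN k; omega
  let μ : ℕ → ProbabilityMeasure Omega := fun k => ⟨emp (x k) (N k), emp_prob _ _ (hN0 k)⟩
  let U : Ultrafilter ℕ := Ultrafilter.of atTop
  have hU : (U : Filter ℕ) ≤ atTop := Ultrafilter.of_le _
  obtain ⟨ν, -, hν⟩ := isCompact_univ.ultrafilter_le_nhds (U.map μ) (by simp)
  have hν : Tendsto μ U (nhds ν) := hν
  have hint := ProbabilityMeasure.tendsto_iff_forall_integral_tendsto.1 hν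
  refine ⟨ν, ⟨inferInstance, ?_, ?_⟩, ?_⟩
  · have := ProbabilityMeasure.limsup_measure_closed_le_of_tendsto hν hcl
    have h2 : (fun i => (μ i : Measure Omega) X) = fun _ => 1 := by
      funext k
      exact emp_X X hcl.measurableSet hinv _ (hx k) _ (hN0 k)
    rw [h2, limsup_const] at this
    exact le_antisymm prob_le_one this
  · have : IsProbabilityMeasure (Measure.map shift (ν : Measure Omega)) :=
      Measure.isProbabilityMeasure_map continuous_shift.measurable.aemeasurable
    refine ext_of_forall_integral_eq_of_IsFiniteMeasure fun f => ?_
    rw [integral_map continuous_shift.measurable.aemeasurable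
      f.continuous.aestronglyMeasurable]
    let g : BoundedContinuousFunction Omega ℝ := f.compContinuous ⟨shift, continuous_shift⟩
    have hd := (hint g).sub (hint f)
    have hz : Tendsto (fun k => ∫ ω, g ω ∂(μ k : Measure Omega) - ∫ ω, f ω ∂(μ k : Measure Omega))
        U (nhds 0) := by
      refine Tendsto.mono_left ?_ hU
      have hb : Tendsto (fun k : ℕ => (2 * ‖f‖) * (1 / ((k : ℝ) + 1))) atTop (nhds 0) := by
        simpa using tendsto_one_div_add_atTop_nhds_zero_nat.const_mul (2 * ‖f‖)
      refine squeeze_zero_norm (fun k => ?_) hb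
      have e : ∫ ω, g ω ∂(μ k : Measure Omega) - ∫ ω, f ω ∂(μ k : Measure Omega)
          = (N k : ℝ)⁻¹ * (f (shift^[N k] (x k)) - f (x k)) := by
        change ∫ ω, g ω ∂(emp (x k) (N k)) - ∫ ω, f ω ∂(emp (x k) (N k)) = _
        rw [emp_integral _ _ _ g.continuous, emp_integral _ _ _ f.continuous, ← mul_sub,
          ← Finset.sum_sub_distrib]
        congr 1
        have := Finset.sum_range_sub (fun i => f (shift^[i] (x k))) (N k)
        simp only [Function.iterate_zero, id] at this
        rw [← this]
        refine Finset.sum_congr rfl fun i _ => ?_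
        rw [Function.iterate_succ_apply']
        rfl
      rw [e, norm_mul, norm_inv, mul_comm]
      have h1 : ‖f (shift^[N k] (x k)) - f (x k)‖ ≤ 2 * ‖f‖ := by
        rw [← dist_eq_norm]; exact f.dist_le_two_norm _ _
      have h2 : ‖(N k : ℝ)‖⁻¹ ≤ 1 / ((k : ℝ) + 1) := by
        rw [Real.norm_natCast, ← one_div]
        exact one_div_le_one_div_of_le (by positivity) (by exact_mod_cast hN k)
      exact mul_le_mul h1 h2 (by positivity) (by positivity)
    exact sub_eq_zero.1 (tendsto_nhds_unique hd hz)
  · have hclopen : IsClopen {x : Omega | x 0 = true} :=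
      (isClopen_discrete {true}).preimage (continuous_apply (0 : ℤ))
    have hI : Continuous (fun y : Omega => if y 0 = true then (1 : ℝ) else 0) :=
      (continuous_of_discreteTopology (f := fun b : Bool => if b = true then (1 : ℝ) else 0)).comp
        (continuous_apply (0 : ℤ))
    let f : BoundedContinuousFunction Omega ℝ := BoundedContinuousFunction.mkOfCompact ⟨_, hI⟩
    have hf := hint f
    have e : ∫ ω, f ω ∂(ν : Measure Omega) = ((ν : Measure Omega) {x | x 0 = true}).toReal := by
      rw [← measureReal_def, ← integral_indicator_one hclopen.1.measurableSet]
      refine integral_congr_ae (Eventually.of_forall fun y => ?_)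
      simp [f, Set.indicator]
    rw [← e]
    refine ge_of_tendsto hf (Eventually.of_forall fun k => ?_)
    change p ≤ ∫ ω, f ω ∂(emp (x k) (N k))
    rw [emp_integral _ _ _ f.continuous]
    have hpos : (0 : ℝ) < N k := by exact_mod_cast Nat.pos_of_ne_zero (hN0 k)
    rw [inv_mul_eq_div, le_div_iff₀ hpos]
    exact hp k

theorem le_dsup (X : Set Omega) (ν : Measure Omega)
    (h : IsProbabilityMeasure ν ∧ ν X = 1 ∧ Measure.map shift ν = ν) :
    (ν {x | x 0 = true}).toReal ≤ dsup X := by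
  refine le_ciSup (f := fun μ : {μ : Measure Omega // IsProbabilityMeasure μ ∧ μ X = 1 ∧
    Measure.map shift μ = μ} => ((μ : Measure Omega) {x | x 0 = true}).toReal) ?_ ⟨ν, h⟩
  refine ⟨1, ?_⟩
  rintro _ ⟨μ, rfl⟩
  have := μ.2.1
  exact ENNReal.toReal_le_of_le_ofReal zero_le_one (by simpa using prob_le_one)

theorem aux_step (X : Set Omega) (hcl : IsClosed X) (hne : X.Nonempty)
    (hinv : shift '' X = X) (h : ℝ)
    (hent : Tendsto (fun n : ℕ => logb 2 ((lang X n).ncard) / n) atTop (nhds h))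
    (p : ℝ) (hp0 : 0 < p) (hp : p ≤ 1 / 2) (hdp : dsup X < p) : h ≤ binEnt p := by
  by_cases hev : ∀ᶠ n : ℕ in atTop, ∀ W ∈ lang X n, (ones W : ℝ) ≤ p * n
  · refine le_of_tendsto hent ?_
    filter_upwards [hev, eventually_gt_atTop 0] with n hn hpos
    have hfin : (lang X n).Finite := Set.toFinite _
    have hnon : hfin.toFinset.Nonempty := by
      obtain ⟨x, hx⟩ := hne
      exact ⟨fun i => x ((i : ℕ) : ℤ), by simpa using ⟨x, hx, fun _ => rfl⟩⟩
    have := aux_count hfin.toFinset hnon p hp0 hp (fun W hW => hn W (by simpa using hW))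
    rw [Set.ncard_eq_toFinset_card _ hfin, binEnt_eq, logb, div_div,
      div_le_div_iff₀ (by positivity) (by positivity)]
    have hl : 0 < Real.log 2 := by positivity
    nlinarith
  · exfalso
    rw [not_eventually, frequently_atTop] at hev
    have : ∀ k : ℕ, ∃ n, k + 1 ≤ n ∧ ∃ x ∈ X,
        p * n ≤ ∑ i ∈ Finset.range n, if (shift^[i] x) 0 = true then (1 : ℝ) else 0 := by
      intro k
      obtain ⟨n, hn, hW⟩ := hev (k + 1)
      push Not at hW
      obtain ⟨W, ⟨x, hx, hxW⟩, hlt⟩ := hW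
      exact ⟨n, hn, x, hx, by rw [← ones_eq x n W hxW]; exact hlt.le⟩
    choose N hN x hx hs using this
    obtain ⟨ν, h1, h2⟩ := aux_measure X hcl hinv p N hN x hx hs
    have := le_dsup X ν h1
    linarith

/-- if `d ≤ 1/2` then the topological entropy `h` of the subshift satisfies
`h ≤ H(d)`. -/
theorem stmt5 (X : Set Omega) (hcl : IsClosed X) (hne : X.Nonempty)
    (hinv : shift '' X = X)
    (h : ℝ)
    (hent : Tendsto (fun n : ℕ => logb 2 ((lang X n).ncard) / n) atTop (nhds h))
    (hd : dsup X ≤ 1 / 2) :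
    h ≤ binEnt (dsup X) := by
  have hd0 : 0 ≤ dsup X := Real.iSup_nonneg fun _ => ENNReal.toReal_nonneg
  have hcont : Continuous binEnt := by
    rw [show binEnt = fun p => binEntropy p / Real.log 2 from funext binEnt_eq]
    exact binEntropy_continuous.div_const _
  rcases hd.lt_or_eq with hlt | heq
  · have ht : Tendsto binEnt (nhdsWithin (dsup X) (Set.Ioi (dsup X))) (nhds (binEnt (dsup X))) :=
      hcont.continuousAt.mono_left nhdsWithin_le_nhds
    refine ge_of_tendsto ht ?_
    filter_upwards [Ioo_mem_nhdsGT hlt] with p hp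
    exact aux_step X hcl hne hinv h hent p (hd0.trans_lt hp.1) hp.2.le hp.1
  · have h1 : binEnt (dsup X) = 1 := by
      rw [heq, binEnt_eq, one_div, binEntropy_two_inv, div_self (by positivity)]
    rw [h1]
    refine le_of_tendsto hent ?_
    filter_upwards [eventually_gt_atTop 0] with n hpos
    have hnon : (lang X n).Nonempty := by
      obtain ⟨x, hx⟩ := hne
      exact ⟨fun i => x ((i : ℕ) : ℤ), x, hx, fun _ => rfl⟩
    have hcard : (lang X n).ncard ≤ 2 ^ n := by
      have := Set.ncard_le_ncard (Set.subset_univ (lang X n)) (Set.toFinite _)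
      simpa [Set.ncard_univ] using this
    have hc0 : 0 < (lang X n).ncard := (Set.ncard_pos (Set.toFinite _)).2 hnon
    rw [div_le_one (by positivity), logb_le_iff_le_rpow (by norm_num) (by exact_mod_cast hc0),
      rpow_natCast]
    exact_mod_cast hcard
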